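/- arXiv:2107.13210 — 7 statements merged into one kernel-verified Lean document; each statement's English description precedes it below -/
import Mathlib

section
/- Assume the feasibility condition δ(1+α) < 1 and let J* be the Jacobian matrix of the vector field (f, εg) at the interior equilibrium E* = (u*, v*). Then det(J*) = ε u* v* / (1+αu*)^3, and in particular det(J*) > 0. -/
/-- Under the feasibility condition `δ(1+α) < 1`, the Jacobian `J*`
of `(f, εg)` at the interior equilibrium `E* = (u*, v*)` satisfies
`det(J*) = ε u* v* / (1+αu*)^3 > 0`. -/
theorem interior_equilibrium_jacobian_det
    (α β γ δ ε : ℝ) (hα : 0 < α) (hβ0 : 0 < β) (hβ1 : β < 1)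
    (hγ : 0 < γ) (hδ : 0 < δ) (hε0 : 0 < ε) (hε1 : ε ≤ 1)
    (hfeas : δ * (1 + α) < 1)
    (f g : ℝ → ℝ → ℝ)
    (hf : ∀ u v, f u v = γ * u * (1 - u) * (u + β) - u * v / (1 + α * u))
    (hg : ∀ u v, g u v = v * (u / (1 + α * u) - δ))
    (q : ℝ → ℝ) (hq : ∀ u, q u = γ * (1 - u) * (u + β) * (1 + α * u))
    (ustar vstar : ℝ)
    (hu : ustar = δ / (1 - α * δ)) (hv : vstar = q ustar)
    (J : Matrix (Fin 2) (Fin 2) ℝ)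
    (hJ : J = !![deriv (fun u => f u vstar) ustar, deriv (fun v => f ustar v) vstar;
                 deriv (fun u => ε * g u vstar) ustar, deriv (fun v => ε * g ustar v) vstar]) :
    J.det = ε * ustar * vstar / (1 + α * ustar) ^ 3 ∧ 0 < J.det := by
  have h1 : 0 < 1 - α * δ := by nlinarith
  have hu0 : 0 < ustar := by rw [hu]; positivity
  have hu1 : ustar < 1 := by rw [hu, div_lt_one h1]; linarith
  have hd : 0 < 1 + α * ustar := by positivity
  have hv0 : 0 < vstar := by
    rw [hv, hq]
    have : 0 < 1 - ustar := by linarith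
    positivity
  have heq : ustar / (1 + α * ustar) - δ = 0 := by
    have h2 : ustar * (1 - α * δ) = δ := by rw [hu]; exact div_mul_cancel₀ _ h1.ne'
    rw [sub_eq_zero, div_eq_iff hd.ne']
    linarith
  have h12 : deriv (fun v => f ustar v) vstar = -(ustar / (1 + α * ustar)) := by
    simp only [hf]
    have h := (((hasDerivAt_id vstar).const_mul ustar).div_const (1 + α * ustar)).const_sub
      (γ * ustar * (1 - ustar) * (ustar + β))
    simpa using h.deriv
  have h22 : deriv (fun v => ε * g ustar v) vstar = 0 := by
    simp only [hg, heq, mul_zero, deriv_const]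
  have h21 : deriv (fun u => ε * g u vstar) ustar = ε * vstar / (1 + α * ustar) ^ 2 := by
    simp only [hg]
    have hden : HasDerivAt (fun u : ℝ => 1 + α * u) (α * 1) ustar :=
      ((hasDerivAt_id ustar).const_mul α).const_add 1
    have h := ((((hasDerivAt_id ustar).div hden hd.ne').sub_const δ).const_mul vstar).const_mul ε
    refine (HasDerivAt.deriv h).trans ?_
    simp only [id]
    field_simp
    ring
  have hdet : J.det = ε * ustar * vstar / (1 + α * ustar) ^ 3 := by
    rw [hJ, Matrix.det_fin_two_of, h12, h22, h21]
    field_simp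
    ring
  refine ⟨hdet, ?_⟩
  rw [hdet]
  positivity
end

section
/- Let u_f = ((α − αβ − 1) + √(1+α+α² − αβ + α²β + α²β²))/(3α) and v_f = q(u_f), with α > 0, 0 < β < 1, γ > 0. Then the fold point P = (u_f, v_f) is nondegenerate: ∂f/∂u(u_f, v_f) = 0, ∂f/∂v(u_f, v_f) = −u_f/(1+αu_f) ≠ 0, ∂²f/∂u²(u_f, v_f) = u_f q″(u_f)/(1+αu_f) < 0, and if moreover δ ≠ u_f/(1+αu_f) then g(u_f, v_f) ≠ 0. -/
/-- The fold point `P = (u_f, v_f)` with `v_f = q(u_f)` is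
nondegenerate: `∂f/∂u(u_f,v_f) = 0`, `∂f/∂v(u_f,v_f) = −u_f/(1+αu_f) ≠ 0`,
`∂²f/∂u²(u_f,v_f) = u_f q″(u_f)/(1+αu_f) < 0`, and if `δ ≠ u_f/(1+αu_f)` then
`g(u_f,v_f) ≠ 0`. -/
theorem fold_point_nondegenerate
    (α β γ δ ε : ℝ) (hα : 0 < α) (hβ0 : 0 < β) (hβ1 : β < 1)
    (hγ : 0 < γ) (hδ : 0 < δ) (hε0 : 0 < ε) (hε1 : ε ≤ 1)
    (f g : ℝ → ℝ → ℝ)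
    (hf : ∀ u v, f u v = γ * u * (1 - u) * (u + β) - u * v / (1 + α * u))
    (hg : ∀ u v, g u v = v * (u / (1 + α * u) - δ))
    (q : ℝ → ℝ) (hq : ∀ u, q u = γ * (1 - u) * (u + β) * (1 + α * u))
    (uf vf : ℝ)
    (huf : uf = ((α - α * β - 1) +
        Real.sqrt (1 + α + α ^ 2 - α * β + α ^ 2 * β + α ^ 2 * β ^ 2)) / (3 * α))
    (hvf : vf = q uf) :
    deriv (fun u => f u vf) uf = 0 ∧
    deriv (fun v => f uf v) vf = -(uf / (1 + α * uf)) ∧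
    deriv (fun v => f uf v) vf ≠ 0 ∧
    deriv (deriv (fun u => f u vf)) uf = uf * deriv (deriv q) uf / (1 + α * uf) ∧
    deriv (deriv (fun u => f u vf)) uf < 0 ∧
    (δ ≠ uf / (1 + α * uf) → g uf vf ≠ 0) := by
  set S := Real.sqrt (1 + α + α ^ 2 - α * β + α ^ 2 * β + α ^ 2 * β ^ 2) with hS
  have hαβ : 0 < α * β := mul_pos hα hβ0
  have hc : 0 < 1 - β + α * β := by linarith
  have hD : 1 + α + α ^ 2 - α * β + α ^ 2 * β + α ^ 2 * β ^ 2
      = (α - α * β - 1) ^ 2 + 3 * α * (1 - β + α * β) := by ring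
  have hDpos : 0 < 1 + α + α ^ 2 - α * β + α ^ 2 * β + α ^ 2 * β ^ 2 := by
    rw [hD]; positivity
  have hSpos : 0 < S := Real.sqrt_pos.mpr hDpos
  have hS2 : S ^ 2 = (α - α * β - 1) ^ 2 + 3 * α * (1 - β + α * β) := by
    rw [← hD]; exact Real.sq_sqrt hDpos.le
  have h3 : 3 * α * uf = (α - α * β - 1) + S := by
    rw [huf]; field_simp
  have hprod : 0 < 3 * α * (1 - β + α * β) := by positivity
  have hAS : 0 < (α - α * β - 1) + S := by
    have := abs_lt_of_sq_lt_sq (a := α - α * β - 1) (b := S) (by linarith) hSpos.le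
    linarith [(abs_lt.mp this).1]
  have hu0 : 0 < uf := by
    have h : 0 < 3 * α * uf := by rw [h3]; exact hAS
    exact pos_of_mul_pos_right h (by positivity)
  have hQ : (1 - β + α * β) + 2 * (α - α * β - 1) * uf - 3 * α * uf ^ 2 = 0 := by
    have hSe : S = 3 * α * uf - (α - α * β - 1) := by linarith
    rw [hSe] at hS2
    have : 3 * α * ((1 - β + α * β) + 2 * (α - α * β - 1) * uf - 3 * α * uf ^ 2) = 0 := by
      linear_combination -hS2
    rcases mul_eq_zero.mp this with h | h
    · linarith
    · exact h
  have hu1 : uf < 1 := by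
    have h : S < 2 * α + α * β + 1 := by
      apply lt_of_pow_lt_pow_left₀ 2 (by positivity)
      rw [hS2]
      have : 0 < α ^ 2 * β := by positivity
      nlinarith [mul_pos hα hα]
    by_contra hcon
    push Not at hcon
    nlinarith
  have hden : 0 < 1 + α * uf := by positivity
  have hv0 : 0 < vf := by
    rw [hvf, hq]
    have : 0 < 1 - uf := by linarith
    positivity
  -- first derivative of f in u, away from the pole
  have hd1 : ∀ u, 1 + α * u ≠ 0 → HasDerivAt (fun u => f u vf)
      (γ * (β + 2 * (1 - β) * u - 3 * u ^ 2) - vf / (1 + α * u) ^ 2) u := by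
    intro u hu
    have hfe : (fun u => f u vf) =
        fun u => γ * u * (1 - u) * (u + β) - u * vf / (1 + α * u) := by
      funext x; exact hf x vf
    rw [hfe]
    have hid := hasDerivAt_id' u
    have h := ((((hid.const_mul γ).mul (hid.const_sub 1)).mul (hid.add_const β))).sub
      ((hid.mul_const vf).div ((hid.const_mul α).const_add 1) hu)
    refine h.congr_deriv ?_
    simp only [Pi.mul_apply]
    field_simp
    ring
  have hd2 : HasDerivAt (deriv (fun u => f u vf))
      (γ * (2 * (1 - β) - 6 * uf) + 2 * α * vf / (1 + α * uf) ^ 3) uf := by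
    have hid := hasDerivAt_id' uf
    have h := ((((hid.const_mul (2 * (1 - β))).const_add β).sub
      ((hid.pow 2).const_mul 3)).const_mul γ).sub
      ((hasDerivAt_const uf vf).div (((hid.const_mul α).const_add 1).pow 2)
        (pow_ne_zero 2 hden.ne'))
    have h' : HasDerivAt (fun u => γ * (β + 2 * (1 - β) * u - 3 * u ^ 2)
        - vf / (1 + α * u) ^ 2)
        (γ * (2 * (1 - β) - 6 * uf) + 2 * α * vf / (1 + α * uf) ^ 3) uf := by
      refine h.congr_deriv ?_
      simp only [Pi.pow_apply]
      field_simp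
      ring
    refine h'.congr_of_eventuallyEq ?_
    have hcont : ContinuousAt (fun u : ℝ => 1 + α * u) uf := by fun_prop
    filter_upwards [hcont.eventually_ne hden.ne'] with u hu
    exact (hd1 u hu).deriv
  have hq1 : deriv q = fun u => γ * ((1 - β + α * β) + 2 * (α - α * β - 1) * u
      - 3 * α * u ^ 2) := by
    funext u
    have hqe : q = fun u => γ * (1 - u) * (u + β) * (1 + α * u) := funext hq
    rw [hqe]
    have hid := hasDerivAt_id' u
    have h := (((hid.const_sub 1).const_mul γ).mul (hid.add_const β)).mul
      ((hid.const_mul α).const_add 1)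
    refine (h.congr_deriv ?_).deriv
    simp only [Pi.mul_apply]
    ring
  have hq2 : deriv (deriv q) uf = γ * (2 * (α - α * β - 1) - 6 * α * uf) := by
    rw [hq1]
    have hid := hasDerivAt_id' uf
    have h := (((hid.const_mul (2 * (α - α * β - 1))).const_add (1 - β + α * β)).sub
      ((hid.pow 2).const_mul (3 * α))).const_mul γ
    refine (h.congr_deriv ?_).deriv
    ring
  have hdv : deriv (fun v => f uf v) vf = -(uf / (1 + α * uf)) := by
    have hfe : (fun v => f uf v) =
        fun v => γ * uf * (1 - uf) * (uf + β) - uf * v / (1 + α * uf) := by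
      funext x; exact hf uf x
    rw [hfe]
    have h := (((hasDerivAt_id' vf).const_mul uf).div_const (1 + α * uf)).const_sub
      (γ * uf * (1 - uf) * (uf + β))
    refine (h.congr_deriv ?_).deriv
    ring
  have hsec : deriv (deriv (fun u => f u vf)) uf
      = uf * deriv (deriv q) uf / (1 + α * uf) := by
    rw [hd2.deriv, hq2, hvf, hq]
    field_simp
    linear_combination 2 * hQ
  refine ⟨?_, hdv, ?_, hsec, ?_, ?_⟩
  · rw [(hd1 uf hden.ne').deriv, hvf, hq]
    field_simp
    linear_combination γ * uf * hQ
  · rw [hdv]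
    exact neg_ne_zero.mpr (div_pos hu0 hden).ne'
  · rw [hsec, hq2]
    have h : 2 * (α - α * β - 1) - 6 * α * uf = -(2 * S) := by linarith
    rw [h]
    apply div_neg_of_neg_of_pos _ hden
    have : 0 < uf * (γ * (2 * S)) := by positivity
    linarith
  · intro hne
    rw [hg]
    exact mul_ne_zero hv0.ne' (sub_ne_zero.mpr hne.symm)
end

section
/- Let b1, b2, b3 be real constants with b2 ≠ 0 and b3 ≠ 0, and define H(U,V) = e^{−(2b2/b3)V} ( (b3/2)U² − b1 b3²/(4 b2²) − (b1 b3/(2 b2)) V ). Then H satisfies ∂H/∂V(U,V) = −e^{−(2b2/b3)V}(−b1 V + b2 U²) and ∂H/∂U(U,V) = e^{−(2b2/b3)V} b3 U; consequently, for every differentiable solution (U(t), V(t)) of the planar Riccati system dU/dt = −b1 V + b2 U², dV/dt = b3 U, the function t ↦ H(U(t), V(t)) is constant. -/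
/-- For `H(U,V) = e^{−(2b2/b3)V}((b3/2)U² − b1b3²/(4b2²) − (b1b3/(2b2))V)`
with `b2 ≠ 0`, `b3 ≠ 0`, one has `∂H/∂V = −e^{−(2b2/b3)V}(−b1V + b2U²)` and
`∂H/∂U = e^{−(2b2/b3)V} b3 U`; consequently `H` is constant along every
differentiable solution of the Riccati system `U′ = −b1V + b2U²`, `V′ = b3U`. -/
theorem riccati_first_integral
    (b1 b2 b3 : ℝ) (hb2 : b2 ≠ 0) (hb3 : b3 ≠ 0)
    (H : ℝ → ℝ → ℝ)
    (hH : ∀ U V, H U V = Real.exp (-(2 * b2 / b3) * V) *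
        (b3 / 2 * U ^ 2 - b1 * b3 ^ 2 / (4 * b2 ^ 2) - b1 * b3 / (2 * b2) * V)) :
    (∀ U V : ℝ, deriv (fun v => H U v) V =
        -Real.exp (-(2 * b2 / b3) * V) * (-b1 * V + b2 * U ^ 2)) ∧
    (∀ U V : ℝ, deriv (fun u => H u V) U =
        Real.exp (-(2 * b2 / b3) * V) * (b3 * U)) ∧
    (∀ U V : ℝ → ℝ,
      (∀ t, HasDerivAt U (-b1 * V t + b2 * (U t) ^ 2) t) →
      (∀ t, HasDerivAt V (b3 * U t) t) →
      ∀ s t : ℝ, H (U s) (V s) = H (U t) (V t)) := by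
  have key : ∀ (U V : ℝ → ℝ) (u' v' t : ℝ), HasDerivAt U u' t → HasDerivAt V v' t →
      HasDerivAt (fun τ => H (U τ) (V τ))
        (Real.exp (-(2 * b2 / b3) * V t) * (b3 * U t) * u' +
          -Real.exp (-(2 * b2 / b3) * V t) * (-b1 * V t + b2 * U t ^ 2) * v') t := by
    intro U V u' v' t hU hV
    simp only [hH]
    have h1 := (hV.const_mul (-(2 * b2 / b3))).exp
    have h2 := (((hU.pow 2).const_mul (b3 / 2)).sub_const (b1 * b3 ^ 2 / (4 * b2 ^ 2))).sub
      (hV.const_mul (b1 * b3 / (2 * b2)))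
    refine (h1.mul h2).congr_deriv ?_
    simp only [Pi.sub_apply, Pi.pow_apply]
    generalize Real.exp (-(2 * b2 / b3) * V t) = e
    field_simp
    push_cast
    ring
  refine ⟨fun U V => ?_, fun U V => ?_, fun U V hU hV s t => ?_⟩
  · have := (key (fun _ => U) (fun v => v) 0 1 V (hasDerivAt_const _ _) (hasDerivAt_id' _)).deriv
    simpa using this
  · have := (key (fun u => u) (fun _ => V) 1 0 U (hasDerivAt_id' _) (hasDerivAt_const _ _)).deriv
    simpa using this
  · have hd : ∀ τ, HasDerivAt (fun τ => H (U τ) (V τ)) 0 τ := fun τ =>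
      (key U V _ _ τ (hU τ) (hV τ)).congr_deriv (by ring)
    exact is_const_of_deriv_eq_zero (fun τ => (hd τ).differentiableAt)
      (fun τ => (hd τ).deriv) s t
end

section
/- Let b1, b2, b3, b4 be real constants with b2 ≠ 0 and b1 b3 > 0, let H(U,V) = e^{−(2b2/b3)V}((b3/2)U² − b1 b3²/(4b2²) − (b1 b3/(2b2))V), and let η(t) = (t, (b2/b1)t² − b3/(2b2)). Then the Melnikov integral d_λ = ∫_{−∞}^{∞} (−b4) (∂H/∂V)(η(t)) dt converges and equals e · A5 · √(π/A4), where A4 = 2b2²/(b1 b3), A5 = b1 b3 b4/(2 b2), and e is Euler's number. -/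
open MeasureTheory Real

/-- The Melnikov integral
`d_λ = ∫ (−b4) ∂H/∂V(η(t)) dt` converges and equals `e · A5 · √(π/A4)`, where
`A4 = 2b2²/(b1b3)`, `A5 = b1b3b4/(2b2)` and `e` is Euler's number. -/
theorem melnikov_integral_d_lambda
    (b1 b2 b3 b4 : ℝ) (hb2 : b2 ≠ 0) (hb13 : 0 < b1 * b3)
    (H : ℝ → ℝ → ℝ)
    (hH : ∀ U V, H U V = Real.exp (-(2 * b2 / b3) * V) *
        (b3 / 2 * U ^ 2 - b1 * b3 ^ 2 / (4 * b2 ^ 2) - b1 * b3 / (2 * b2) * V))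
    (η : ℝ → ℝ × ℝ)
    (hη : ∀ t, η t = (t, b2 / b1 * t ^ 2 - b3 / (2 * b2)))
    (A4 A5 : ℝ)
    (hA4 : A4 = 2 * b2 ^ 2 / (b1 * b3))
    (hA5 : A5 = b1 * b3 * b4 / (2 * b2)) :
    MeasureTheory.Integrable
      (fun t : ℝ => -b4 * deriv (fun v => H (η t).1 v) (η t).2) ∧
    ∫ t : ℝ, -b4 * deriv (fun v => H (η t).1 v) (η t).2 =
      Real.exp 1 * A5 * Real.sqrt (Real.pi / A4) := by
  have hb1 : b1 ≠ 0 := left_ne_zero_of_mul hb13.ne'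
  have hb3 : b3 ≠ 0 := right_ne_zero_of_mul hb13.ne'
  have hA4pos : 0 < A4 := by rw [hA4]; positivity
  have key : (fun t : ℝ => -b4 * deriv (fun v => H (η t).1 v) (η t).2) =
      fun t : ℝ => (Real.exp 1 * A5) * Real.exp (-A4 * t ^ 2) := by
    funext t
    rw [hη t]
    simp only [hH]
    set V := b2 / b1 * t ^ 2 - b3 / (2 * b2) with hV
    have h1 : HasDerivAt (fun v : ℝ => Real.exp (-(2 * b2 / b3) * v))
        (Real.exp (-(2 * b2 / b3) * V) * (-(2 * b2 / b3) * 1)) V :=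
      ((hasDerivAt_id V).const_mul _).exp
    have h2 : HasDerivAt (fun v : ℝ => b3 / 2 * t ^ 2 - b1 * b3 ^ 2 / (4 * b2 ^ 2)
        - b1 * b3 / (2 * b2) * v) (-(b1 * b3 / (2 * b2) * 1)) V :=
      ((hasDerivAt_id V).const_mul _).const_sub _
    have h0 : b3 / 2 * t ^ 2 - b1 * b3 ^ 2 / (4 * b2 ^ 2) - b1 * b3 / (2 * b2) * V = 0 := by
      rw [hV]; field_simp; ring
    have he : -(2 * b2 / b3) * V = 1 + -A4 * t ^ 2 := by
      rw [hV, hA4]; field_simp; ring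
    have h3 := (h1.mul h2).deriv
    rw [h0, he, Real.exp_add] at h3
    refine (congrArg (fun x => -b4 * x) h3).trans ?_
    simp only [hA5]
    ring
  rw [key]
  refine ⟨(integrable_exp_neg_mul_sq hA4pos).const_mul _, ?_⟩
  rw [MeasureTheory.integral_const_mul, integral_gaussian]
end

section
/- Let a1, a2, a3, a4, a5 and b1, b2, b3 be real constants with b2 ≠ 0 and b1 b3 > 0. Let H(U,V) = e^{−(2b2/b3)V}((b3/2)U² − b1 b3²/(4b2²) − (b1 b3/(2b2))V), η(t) = (t, (b2/b1)t² − b3/(2b2)), and 𝒢(U,V) = (a1 U − a2 U V + a3 U³, a4 U² + a5 V). Then the Melnikov integral d_r = ∫_{−∞}^{∞} ∇H(η(t))ᵀ 𝒢(η(t)) dt converges and equals e · (3A1/(4A4²) + A2/(2A4) + A3) · √(π/A4), where A1 = a3 b3 − a2 b2 b3/b1, A2 = a1 b3 + a2 b3²/(2b2) − a4 b1 b3/(2b2) − a5 b3/2, A3 = a5 b1 b3²/(4b2²), A4 = 2b2²/(b1 b3), and e is Euler's number. -/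
open MeasureTheory Real

theorem gauss_pow_integrable {b : ℝ} (hb : 0 < b) (n : ℕ) :
    Integrable (fun t : ℝ => t ^ n * Real.exp (-b * t ^ 2)) := by
  have h := integrable_rpow_mul_exp_neg_mul_sq hb (s := (n : ℝ))
    (by have : (0 : ℝ) ≤ n := Nat.cast_nonneg n
        linarith)
  simpa only [Real.rpow_natCast] using h

theorem gauss_pow_rec {b : ℝ} (hb : 0 < b) (n : ℕ) :
    ∫ t : ℝ, t ^ (n + 2) * Real.exp (-b * t ^ 2) =
      (n + 1) / (2 * b) * ∫ t : ℝ, t ^ n * Real.exp (-b * t ^ 2) := by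
  have hd : ∀ t : ℝ, HasDerivAt (fun t : ℝ => t ^ (n + 1) * Real.exp (-b * t ^ 2))
      ((n + 1) * (t ^ n * Real.exp (-b * t ^ 2))
        - 2 * b * (t ^ (n + 2) * Real.exp (-b * t ^ 2))) t := by
    intro t
    have h1 := hasDerivAt_pow (n + 1) t
    have h2 := ((hasDerivAt_pow 2 t).const_mul (-b)).exp
    refine (h1.mul h2).congr_deriv ?_
    push_cast
    ring
  have i1 := (gauss_pow_integrable hb n).const_mul ((n : ℝ) + 1)
  have i2 := (gauss_pow_integrable hb (n + 2)).const_mul (2 * b)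
  have h := integral_eq_zero_of_hasDerivAt_of_integrable hd (i1.sub i2)
    (gauss_pow_integrable hb (n + 1))
  rw [integral_sub i1 i2, integral_const_mul, integral_const_mul] at h
  rw [div_mul_eq_mul_div, eq_div_iff (by positivity)]
  linarith

/-- The Melnikov integral
`d_r = ∫ ∇H(η(t))ᵀ 𝒢(η(t)) dt` converges and equals
`e · (3A1/(4A4²) + A2/(2A4) + A3) · √(π/A4)`, where `𝒢(U,V) = (a1U − a2UV + a3U³,
a4U² + a5V)` and the constants `A1, …, A4` are as given. -/
theorem melnikov_integral_d_r
    (a1 a2 a3 a4 a5 b1 b2 b3 : ℝ) (hb2 : b2 ≠ 0) (hb13 : 0 < b1 * b3)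
    (H : ℝ → ℝ → ℝ)
    (hH : ∀ U V, H U V = Real.exp (-(2 * b2 / b3) * V) *
        (b3 / 2 * U ^ 2 - b1 * b3 ^ 2 / (4 * b2 ^ 2) - b1 * b3 / (2 * b2) * V))
    (η : ℝ → ℝ × ℝ)
    (hη : ∀ t, η t = (t, b2 / b1 * t ^ 2 - b3 / (2 * b2)))
    (G1 G2 : ℝ → ℝ → ℝ)
    (hG1 : ∀ U V, G1 U V = a1 * U - a2 * U * V + a3 * U ^ 3)
    (hG2 : ∀ U V, G2 U V = a4 * U ^ 2 + a5 * V)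
    (A1 A2 A3 A4 : ℝ)
    (hA1 : A1 = a3 * b3 - a2 * b2 * b3 / b1)
    (hA2 : A2 = a1 * b3 + a2 * b3 ^ 2 / (2 * b2) - a4 * b1 * b3 / (2 * b2) - a5 * b3 / 2)
    (hA3 : A3 = a5 * b1 * b3 ^ 2 / (4 * b2 ^ 2))
    (hA4 : A4 = 2 * b2 ^ 2 / (b1 * b3)) :
    MeasureTheory.Integrable
      (fun t : ℝ => deriv (fun u => H u (η t).2) (η t).1 * G1 (η t).1 (η t).2 +
        deriv (fun v => H (η t).1 v) (η t).2 * G2 (η t).1 (η t).2) ∧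
    ∫ t : ℝ, (deriv (fun u => H u (η t).2) (η t).1 * G1 (η t).1 (η t).2 +
        deriv (fun v => H (η t).1 v) (η t).2 * G2 (η t).1 (η t).2) =
      Real.exp 1 * (3 * A1 / (4 * A4 ^ 2) + A2 / (2 * A4) + A3) *
        Real.sqrt (Real.pi / A4) := by
  have hb1 : b1 ≠ 0 := by rintro rfl; simp at hb13
  have hb3 : b3 ≠ 0 := by rintro rfl; simp at hb13
  have hA4pos : 0 < A4 := by rw [hA4]; positivity
  have key : (fun t : ℝ => deriv (fun u => H u (η t).2) (η t).1 * G1 (η t).1 (η t).2 +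
        deriv (fun v => H (η t).1 v) (η t).2 * G2 (η t).1 (η t).2) =
      fun t : ℝ => Real.exp 1 * A1 * (t ^ 4 * Real.exp (-A4 * t ^ 2)) +
        Real.exp 1 * A2 * (t ^ 2 * Real.exp (-A4 * t ^ 2)) +
        Real.exp 1 * A3 * (t ^ 0 * Real.exp (-A4 * t ^ 2)) := by
    funext t
    have hU : ∀ U V, HasDerivAt (fun u => H u V)
        (Real.exp (-(2 * b2 / b3) * V) * (b3 * U)) U := by
      intro U V
      simp only [hH]
      have h := (((((hasDerivAt_pow 2 U).const_mul (b3 / 2)).sub_const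
        (b1 * b3 ^ 2 / (4 * b2 ^ 2))).sub_const (b1 * b3 / (2 * b2) * V)).const_mul
        (Real.exp (-(2 * b2 / b3) * V)))
      refine h.congr_deriv ?_
      push_cast
      ring
    have hV : ∀ U V, HasDerivAt (fun v => H U v)
        (Real.exp (-(2 * b2 / b3) * V) * (-(2 * b2 / b3) *
          (b3 / 2 * U ^ 2 - b1 * b3 ^ 2 / (4 * b2 ^ 2) - b1 * b3 / (2 * b2) * V)
          - b1 * b3 / (2 * b2))) V := by
      intro U V
      simp only [hH]
      have h := (((hasDerivAt_id' V).const_mul (-(2 * b2 / b3))).exp).mul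
        (((hasDerivAt_id' V).const_mul (b1 * b3 / (2 * b2))).const_sub
          (b3 / 2 * U ^ 2 - b1 * b3 ^ 2 / (4 * b2 ^ 2)))
      refine h.congr_deriv ?_
      ring
    have hexp : Real.exp (-(2 * b2 / b3) * (b2 / b1 * t ^ 2 - b3 / (2 * b2))) =
        Real.exp 1 * Real.exp (-A4 * t ^ 2) := by
      rw [← Real.exp_add, hA4]
      congr 1
      field_simp
      ring
    rw [(hU _ _).deriv, (hV _ _).deriv, hG1, hG2, hη]
    simp only
    rw [hexp, hA1, hA2, hA3]
    generalize Real.exp (-A4 * t ^ 2) = E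
    field_simp
    ring
  have i4 := (gauss_pow_integrable hA4pos 4).const_mul (Real.exp 1 * A1)
  have i2 := (gauss_pow_integrable hA4pos 2).const_mul (Real.exp 1 * A2)
  have i0 := (gauss_pow_integrable hA4pos 0).const_mul (Real.exp 1 * A3)
  have m0 : ∫ t : ℝ, t ^ 0 * Real.exp (-A4 * t ^ 2) = Real.sqrt (Real.pi / A4) := by
    simpa using integral_gaussian A4
  have m2 := gauss_pow_rec hA4pos 0
  have m4 := gauss_pow_rec hA4pos 2
  norm_num only at m2 m4
  rw [key]
  refine ⟨(i4.add i2).add i0, ?_⟩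
  have i42 : Integrable (fun t : ℝ => Real.exp 1 * A1 * (t ^ 4 * Real.exp (-A4 * t ^ 2)) +
      Real.exp 1 * A2 * (t ^ 2 * Real.exp (-A4 * t ^ 2))) := i4.add i2
  rw [integral_add i42 i0, integral_add i4 i2, integral_const_mul, integral_const_mul,
    integral_const_mul, m4, m2, m0]
  field_simp
  ring
end

section
/- Let γ > 0, β > 0 and let v1 > γβ. Then there exists a unique v0 ∈ (0, γβ) such that (v1 − v0) = γβ ln(v1/v0); i.e., the entry–exit function has a well-defined exit point p(v1) = v0 strictly between 0 and γβ. -/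
lemma aux_log_anti (c a b : ℝ) (ha : 0 < a) (hab : a < b) (hb : b ≤ c) :
    b - a < c * (Real.log b - Real.log a) := by
  have hb0 : 0 < b := ha.trans hab
  have h := Real.log_lt_sub_one_of_pos (div_pos ha hb0) ((div_lt_one hb0).2 hab).ne
  rw [Real.log_div ha.ne' hb0.ne'] at h
  have h1 : (b - a) / b < Real.log b - Real.log a := by
    rw [sub_div, div_self hb0.ne']; linarith
  have h2 : b - a < b * (Real.log b - Real.log a) := by
    rw [div_lt_iff₀ hb0] at h1; linarith
  have h3 : 0 < Real.log b - Real.log a := sub_pos.2 (Real.log_lt_log ha hab)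
  nlinarith

/-- For `γ, β > 0` and `v1 > γβ`, there exists a unique
`v0 ∈ (0, γβ)` with `(v1 − v0) = γβ ln(v1/v0)`: the entry–exit function has a
well-defined exit point `p(v1) = v0` strictly between `0` and `γβ`. -/
theorem entry_exit_point_exists_unique
    (γ β v1 : ℝ) (hγ : 0 < γ) (hβ : 0 < β) (hv1 : γ * β < v1) :
    ∃! v0 : ℝ, v0 ∈ Set.Ioo (0 : ℝ) (γ * β) ∧
      v1 - v0 = γ * β * Real.log (v1 / v0) := by
  have hc : 0 < γ * β := mul_pos hγ hβ
  generalize γ * β = c at *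
  have hv : 0 < v1 := hc.trans hv1
  have hex : 0 < Real.exp (v1 / c) := Real.exp_pos _
  have ha : 0 < v1 / Real.exp (v1 / c) := div_pos hv hex
  have hla : Real.log (v1 / Real.exp (v1 / c)) = Real.log v1 - v1 / c := by
    rw [Real.log_div hv.ne' hex.ne', Real.log_exp]
  generalize haa : v1 / Real.exp (v1 / c) = a at *
  have hac : a < c := by
    rw [← haa, div_lt_iff₀ hex]
    have := Real.add_one_le_exp (v1 / c)
    have h2 : v1 / c < Real.exp (v1 / c) := by linarith
    rw [div_lt_iff₀ hc] at h2; linarith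
  have hcont : ContinuousOn (fun v => v1 - v - c * (Real.log v1 - Real.log v))
      (Set.Icc a c) := by
    refine ContinuousOn.sub (by fun_prop) (continuousOn_const.mul (continuousOn_const.sub ?_))
    exact Real.continuousOn_log.mono fun x hx => (ha.trans_le hx.1).ne'
  have h0 : (0 : ℝ) ∈ Set.Ioo (v1 - a - c * (Real.log v1 - Real.log a))
      (v1 - c - c * (Real.log v1 - Real.log c)) := by
    constructor
    · rw [hla]
      have : c * (Real.log v1 - (Real.log v1 - v1 / c)) = v1 := by field_simp; ring
      linarith
    · have h := Real.log_lt_sub_one_of_pos (div_pos hv hc) ((one_lt_div hc).2 hv1).ne'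
      rw [Real.log_div hv.ne' hc.ne'] at h
      have h' := mul_lt_mul_of_pos_left h hc
      have : c * (v1 / c - 1) = v1 - c := by field_simp
      linarith
  obtain ⟨x, hx, hfx⟩ := intermediate_value_Ioo hac.le hcont h0
  have hx0 : 0 < x := ha.trans hx.1
  simp only at hfx
  refine ⟨x, ⟨⟨hx0, hx.2⟩, ?_⟩, ?_⟩
  · rw [Real.log_div hv.ne' hx0.ne']; linarith
  · rintro y ⟨⟨hy0, hyc⟩, hy⟩
    rw [Real.log_div hv.ne' hy0.ne'] at hy
    rcases lt_trichotomy y x with h | h | h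
    · have := aux_log_anti c y x hy0 h hx.2.le
      linarith
    · exact h
    · have := aux_log_anti c x y hx0 h hyc.le
      linarith
end

section
/- Let J* be the Jacobian matrix of the vector field (f, εg) at the interior equilibrium E* = (u*, v*) under the feasibility condition δ(1+α) < 1, and assume tr(J*) < 0 (so that E* is linearly stable for the non-spatial system). Then for every diffusion ratio d > 0 and every wavenumber k ≥ 0, the matrix J* − k² diag(1, d) has strictly negative trace and strictly positive determinant; hence the homogeneous steady state E* of the reaction–diffusion system u_t = f + ∇²u, v_t = εg + d∇²v is linearly stable against all spatially heterogeneous perturbations, i.e. the Turing instability condition is never satisfied. -/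
/-- If the interior equilibrium is linearly stable for the
non-spatial system (`tr J* < 0`), then for every diffusion ratio `d > 0` and
wavenumber `k ≥ 0` the matrix `J* − k² diag(1,d)` has negative trace and
positive determinant: the homogeneous steady state is stable against all
spatially heterogeneous perturbations, i.e. no Turing instability occurs. -/
theorem no_turing_instability
    (α β γ δ ε : ℝ) (hα : 0 < α) (hβ0 : 0 < β) (hβ1 : β < 1)
    (hγ : 0 < γ) (hδ : 0 < δ) (hε0 : 0 < ε) (hε1 : ε ≤ 1)
    (hfeas : δ * (1 + α) < 1)
    (f g : ℝ → ℝ → ℝ)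
    (hf : ∀ u v, f u v = γ * u * (1 - u) * (u + β) - u * v / (1 + α * u))
    (hg : ∀ u v, g u v = v * (u / (1 + α * u) - δ))
    (q : ℝ → ℝ) (hq : ∀ u, q u = γ * (1 - u) * (u + β) * (1 + α * u))
    (ustar vstar : ℝ)
    (hu : ustar = δ / (1 - α * δ)) (hv : vstar = q ustar)
    (J : Matrix (Fin 2) (Fin 2) ℝ)
    (hJ : J = !![deriv (fun u => f u vstar) ustar, deriv (fun v => f ustar v) vstar;
                 deriv (fun u => ε * g u vstar) ustar, deriv (fun v => ε * g ustar v) vstar])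
    (htr : J.trace < 0) :
    ∀ d : ℝ, 0 < d → ∀ k : ℝ, 0 ≤ k →
      (J - k ^ 2 • !![(1 : ℝ), 0; 0, d]).trace < 0 ∧
      0 < (J - k ^ 2 • !![(1 : ℝ), 0; 0, d]).det := by
  have h1 : 0 < 1 - α * δ := by nlinarith
  have hu0 : 0 < ustar := by rw [hu]; positivity
  have hu1 : ustar < 1 := by
    rw [hu, div_lt_one h1]; nlinarith
  have hp : 0 < 1 + α * ustar := by positivity
  have heq : ustar / (1 + α * ustar) = δ := by
    rw [div_eq_iff hp.ne']
    have : ustar * (1 - α * δ) = δ := by rw [hu]; exact div_mul_cancel₀ δ h1.ne'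
    linarith
  have hv0 : 0 < vstar := by
    rw [hv, hq]
    have : 0 < 1 - ustar := by linarith
    positivity
  have h12 : deriv (fun v => f ustar v) vstar = -δ := by
    have e : (fun v => f ustar v) =
        fun v => γ * ustar * (1 - ustar) * (ustar + β) - δ * v := by
      funext v
      rw [hf, ← heq]; ring
    rw [e]
    have := ((hasDerivAt_id vstar).const_mul δ).const_sub
      (γ * ustar * (1 - ustar) * (ustar + β))
    simpa using this.deriv
  have h22 : deriv (fun v => ε * g ustar v) vstar = 0 := by
    have e : (fun v => ε * g ustar v) = fun _ => 0 := by
      funext v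
      rw [hg, heq]; ring
    rw [e]; simp
  have h21 : deriv (fun u => ε * g u vstar) ustar = ε * vstar / (1 + α * ustar) ^ 2 := by
    have e : (fun u => ε * g u vstar) = fun u => ε * (vstar * (u / (1 + α * u) - δ)) := by
      funext u
      rw [hg]
    rw [e]
    have hd : HasDerivAt (fun u : ℝ => 1 + α * u) (α * 1) ustar :=
      ((hasDerivAt_id ustar).const_mul α).const_add 1
    have := (((((hasDerivAt_id ustar).fun_div hd hp.ne').sub_const δ).const_mul vstar).const_mul ε).deriv
    simp only [id] at this
    rw [this]
    field_simp
    ring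
  have h21p : 0 < ε * vstar / (1 + α * ustar) ^ 2 := by positivity
  rw [h12, h21, h22] at hJ
  generalize deriv (fun u => f u vstar) ustar = a at hJ
  generalize ε * vstar / (1 + α * ustar) ^ 2 = c at hJ h21p
  subst hJ
  have ha : a < 0 := by simpa [Matrix.trace_fin_two] using htr
  intro d hd k _
  have hk : 0 ≤ k ^ 2 := sq_nonneg k
  have hkd : 0 ≤ k ^ 2 * d := by positivity
  have hc : 0 < δ * c := by positivity
  constructor
  · simp [Matrix.trace_fin_two]
    nlinarith
  · simp [Matrix.det_fin_two]
    nlinarith [mul_nonneg hkd (by linarith : 0 ≤ k ^ 2 - a)]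
end
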